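/- arXiv:2211.12721 — 2 statements merged into one kernel-verified Lean document; each statement's English description precedes it below -/
import Mathlib

section
/- For every ε ∈ (0,1), every 3-uniform hypergraph H on n ≥ (2/ε)^(5/ε²+2) vertices in which every pair of vertices has codegree at least εn contains a copy of C₅⁻, the tight cycle on 5 vertices minus one edge. -/
/-- Vertices of an edge `{x, y, z}` of size three are distinct. -/
lemma C5aux_distinct {V : Type} [DecidableEq V] {x y z : V}
    (h : ({x, y, z} : Finset V).card = 3) : x ≠ y ∧ x ≠ z ∧ y ≠ z := by
  have h2 : ∀ a b : V, ({a, b} : Finset V).card ≠ 3 := fun a b hab => by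
    have := Finset.card_le_two (a := a) (b := b)
    omega
  refine ⟨?_, ?_, ?_⟩
  · rintro rfl
    exact h2 x z (by simpa using h)
  · rintro rfl
    exact h2 y x (by simpa using h)
  · rintro rfl
    exact h2 x y (by simpa using h)

/-- Codegrees count common neighbours. -/
lemma C5aux_nbhd {V : Type} [Fintype V] [DecidableEq V] (E : Finset (Finset V))
    (h3 : ∀ e ∈ E, e.card = 3) (u v : V) (huv : u ≠ v) :
    (E.filter fun e => u ∈ e ∧ v ∈ e).card ≤
      (Finset.univ.filter fun w => ({u, v, w} : Finset V) ∈ E).card := by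
  refine le_trans (Finset.card_le_card ?_)
    (Finset.card_image_le (f := fun w => ({u, v, w} : Finset V)))
  intro e he
  rw [Finset.mem_filter] at he
  obtain ⟨heE, hu, hv⟩ := he
  have hc := h3 e heE
  have hsub : ({u, v} : Finset V) ⊆ e := by
    intro x hx
    simp only [Finset.mem_insert, Finset.mem_singleton] at hx
    rcases hx with rfl | rfl <;> assumption
  have hcard : (e \ {u, v}).card = 1 := by
    rw [Finset.card_sdiff_of_subset hsub, Finset.card_pair huv, hc]
  obtain ⟨w, hw⟩ := Finset.card_eq_one.mp hcard
  have heq : ({u, v, w} : Finset V) = e := by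
    rw [← Finset.sdiff_union_of_subset hsub, hw]
    ext x
    simp only [Finset.mem_insert, Finset.mem_singleton, Finset.mem_union]
    tauto
  rw [Finset.mem_image]
  exact ⟨w, by simp [heq, heE], heq⟩

/-- One step: a set `S` and `c ∈ S`; some `b` has many neighbours in `S` in the link of `c`. -/
lemma C5aux_step {V : Type} [Fintype V] [DecidableEq V] (E : Finset (Finset V)) (ε : ℝ)
    (hN : ∀ u v : V, u ≠ v → ε * (Fintype.card V : ℝ) ≤
      ((Finset.univ.filter fun w => ({u, v, w} : Finset V) ∈ E).card : ℝ))
    (S : Finset V) (c : V) (hc : c ∈ S) :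
    ∃ b : V, ε * ((S.card : ℝ) - 1) ≤
      (((S.erase c).filter fun s => ({c, s, b} : Finset V) ∈ E).card : ℝ) := by
  by_contra hcon
  push Not at hcon
  have hdc : ∑ s ∈ S.erase c, (Finset.univ.filter fun w => ({c, s, w} : Finset V) ∈ E).card
      = ∑ b : V, ((S.erase c).filter fun s => ({c, s, b} : Finset V) ∈ E).card :=
    Finset.sum_card_bipartiteAbove_eq_sum_card_bipartiteBelow
      (fun s b => ({c, s, b} : Finset V) ∈ E)
  have hdc' : ∑ s ∈ S.erase c,
        ((Finset.univ.filter fun w => ({c, s, w} : Finset V) ∈ E).card : ℝ)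
      = ∑ b : V, (((S.erase c).filter fun s => ({c, s, b} : Finset V) ∈ E).card : ℝ) := by
    exact_mod_cast hdc
  have hlt : ∑ b : V, (((S.erase c).filter fun s => ({c, s, b} : Finset V) ∈ E).card : ℝ)
      < ∑ _b : V, ε * ((S.card : ℝ) - 1) :=
    Finset.sum_lt_sum_of_nonempty ⟨c, Finset.mem_univ c⟩ fun b _ => hcon b
  have hge : ∑ _s ∈ S.erase c, ε * (Fintype.card V : ℝ) ≤ ∑ s ∈ S.erase c,
        ((Finset.univ.filter fun w => ({c, s, w} : Finset V) ∈ E).card : ℝ) :=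
    Finset.sum_le_sum fun s hs => hN c s (Finset.ne_of_mem_erase hs).symm
  have hSc : ((S.erase c).card : ℝ) = (S.card : ℝ) - 1 := by
    have := Finset.card_erase_add_one hc
    have h' : ((S.erase c).card : ℝ) + 1 = S.card := by exact_mod_cast this
    linarith
  rw [Finset.sum_const, nsmul_eq_mul, hSc] at hge
  rw [Finset.sum_const, nsmul_eq_mul, Finset.card_univ] at hlt
  nlinarith

/-- Long chains `c 0, …, c m` with witnesses `b i` such that `{b i, c i, c j}` is an edge
for all `i < j`. -/
lemma C5aux_chain {V : Type} [Fintype V] [DecidableEq V] (E : Finset (Finset V)) (ε : ℝ)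
    (hε : 0 < ε) (hε1 : ε < 1)
    (hN : ∀ u v : V, u ≠ v → ε * (Fintype.card V : ℝ) ≤
      ((Finset.univ.filter fun w => ({u, v, w} : Finset V) ∈ E).card : ℝ)) (m : ℕ) :
    ∀ S : Finset V, 2 * (2 / ε) ^ m ≤ (S.card : ℝ) →
      ∃ c b : ℕ → V, (∀ i ≤ m, c i ∈ S) ∧
        ∀ i j, i < j → j ≤ m → ({c i, c j, b i} : Finset V) ∈ E := by
  have h1 : 1 ≤ 2 / ε := by rw [le_div_iff₀ hε]; linarith
  induction m with
  | zero =>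
    intro S hS
    have hpos : 0 < S.card := by
      have : (0 : ℝ) < S.card := by
        rw [pow_zero] at hS
        linarith
      exact_mod_cast this
    obtain ⟨c, hc⟩ := Finset.card_pos.mp hpos
    exact ⟨fun _ => c, fun _ => c, fun _ _ => hc, fun i j hij hj => by omega⟩
  | succ m ih =>
    intro S hS
    have h2 : (2 : ℝ) ≤ S.card := by
      have := one_le_pow₀ h1 (n := m + 1)
      linarith
    have hpos : 0 < S.card := by
      have : (0 : ℝ) < S.card := by linarith
      exact_mod_cast this
    obtain ⟨c, hc⟩ := Finset.card_pos.mp hpos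
    obtain ⟨b, hb⟩ := C5aux_step E ε hN S c hc
    obtain ⟨c', b', hc', hb'⟩ := ih ((S.erase c).filter fun s => ({c, s, b} : Finset V) ∈ E) (by
      refine le_trans ?_ hb
      have e1 : 2 * (2 / ε) ^ m = (ε / 2) * (2 * (2 / ε) ^ (m + 1)) := by
        rw [pow_succ]; field_simp
      rw [e1]
      nlinarith)
    simp only [Finset.mem_filter, Finset.mem_erase] at hc'
    refine ⟨fun i => Nat.casesOn i c c', fun i => Nat.casesOn i b b', ?_, ?_⟩
    · rintro (_ | i) hi
      · exact hc
      · exact (hc' i (by omega)).1.2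
    · rintro (_ | i) (_ | j) hij hj
      · omega
      · exact (hc' j (by omega)).2
      · omega
      · exact hb' i j (by omega) (by omega)

/-- For every ε ∈ (0,1), every 3-uniform hypergraph `H` on
`n ≥ (2/ε)^(5/ε²+2)` vertices in which every pair of distinct vertices has codegree at
least `εn` contains a copy of `C₅⁻`, the tight cycle on 5 vertices minus one edge
(here the missing edge is the one at index `0`). -/
theorem codegree_C5_minus (ε : ℝ) (hε : ε ∈ Set.Ioo (0 : ℝ) 1)
    (V : Type) [Fintype V] [DecidableEq V] (E : Finset (Finset V))
    (h3 : ∀ e ∈ E, e.card = 3)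
    (hn : (2 / ε) ^ ((5 : ℝ) / ε ^ 2 + 2) ≤ (Fintype.card V : ℝ))
    (hcodeg : ∀ u v : V, u ≠ v →
      ε * (Fintype.card V : ℝ) ≤ ((E.filter fun e => u ∈ e ∧ v ∈ e).card : ℝ)) :
    ∃ f : ZMod 5 → V, Function.Injective f ∧
      ∀ i : ZMod 5, i ≠ 0 → ({f i, f (i + 1), f (i + 2)} : Finset V) ∈ E := by
  obtain ⟨hε0, hε1⟩ := hε
  have hN : ∀ u v : V, u ≠ v → ε * (Fintype.card V : ℝ) ≤
      ((Finset.univ.filter fun w => ({u, v, w} : Finset V) ∈ E).card : ℝ) := fun u v huv =>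
    (hcodeg u v huv).trans (by exact_mod_cast C5aux_nbhd E h3 u v huv)
  have h2 : 2 ≤ 2 / ε := by rw [le_div_iff₀ hε0]; linarith
  set k := ⌈2 / ε⌉₊ with hk
  have hk1 : 2 / ε ≤ k := Nat.le_ceil _
  have hk2 : (k : ℝ) < 2 / ε + 1 := Nat.ceil_lt_add_one (by linarith)
  have hexp : ((k + 1 : ℕ) : ℝ) ≤ (5 : ℝ) / ε ^ 2 + 2 := by
    have : 2 / ε ≤ 5 / ε ^ 2 := by
      rw [div_le_div_iff₀ hε0 (by positivity)]
      nlinarith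
    push_cast
    linarith
  have hbig : (2 / ε) ^ (k + 1) ≤ (Fintype.card V : ℝ) := by
    refine le_trans ?_ hn
    rw [← Real.rpow_natCast]
    exact Real.rpow_le_rpow_of_exponent_le (by linarith) hexp
  have hkpos : 0 < k := by
    have : (0 : ℝ) < k := by linarith
    exact_mod_cast this
  have hpk : 2 / ε ≤ (2 / ε) ^ k := le_self_pow₀ (by linarith) hkpos.ne'
  have hcard : 2 / ε < (Fintype.card V : ℝ) := by
    rw [pow_succ] at hbig
    nlinarith
  obtain ⟨c, b, -, hE⟩ := C5aux_chain E ε hε0 hε1 hN k Finset.univ (by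
    rw [Finset.card_univ]
    refine le_trans ?_ hbig
    rw [pow_succ]
    nlinarith)
  have hd : ∀ i j, i < j → j ≤ k → c i ≠ c j ∧ c i ≠ b i ∧ c j ≠ b i := fun i j hij hj =>
    C5aux_distinct (h3 _ (hE i j hij hj))
  -- pigeonhole in the link of the last vertex
  let T : ℕ → Finset V := fun i =>
    (Finset.univ.filter fun w => ({c k, c i, w} : Finset V) ∈ E).erase (b i)
  have hT : ∀ i < k, ε * (Fintype.card V : ℝ) - 1 ≤ ((T i).card : ℝ) := by
    intro i hi
    have ha := hN (c k) (c i) (hd i k hi le_rfl).1.symm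
    have hb := Nat.sub_le_iff_le_add.mp (Finset.pred_card_le_card_erase
      (s := Finset.univ.filter fun w => ({c k, c i, w} : Finset V) ∈ E) (a := b i))
    have hb' : ((Finset.univ.filter fun w => ({c k, c i, w} : Finset V) ∈ E).card : ℝ) ≤
      ((T i).card : ℝ) + 1 := by exact_mod_cast hb
    linarith
  have hex : ∃ i j, i < j ∧ j < k ∧ ∃ w, w ∈ T i ∧ w ∈ T j := by
    by_contra hcon
    push Not at hcon
    have hdisj : ∀ i j, i < j → j < k → Disjoint (T i) (T j) := fun i j hij hj =>
      Finset.disjoint_left.mpr fun w hw hw' => hcon i j hij hj w hw hw'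
    have hsum : ∑ i ∈ Finset.range k, (T i).card ≤ Fintype.card V := by
      rw [← Finset.card_biUnion]
      · exact Finset.card_le_univ _
      · intro i hi j hj hij
        rw [Finset.mem_coe, Finset.mem_range] at hi hj
        rcases lt_or_gt_of_ne hij with h | h
        · exact hdisj i j h hj
        · exact (hdisj j i h hi).symm
    have hsum' : ∑ i ∈ Finset.range k, ((T i).card : ℝ) ≤ Fintype.card V := by
      exact_mod_cast hsum
    have hlow : ∑ _i ∈ Finset.range k, (ε * (Fintype.card V : ℝ) - 1) ≤
        ∑ i ∈ Finset.range k, ((T i).card : ℝ) :=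
      Finset.sum_le_sum fun i hi => hT i (Finset.mem_range.mp hi)
    rw [Finset.sum_const, nsmul_eq_mul, Finset.card_range] at hlow
    have hp : 0 ≤ ε * (Fintype.card V : ℝ) - 1 := by
      rw [div_lt_iff₀ hε0] at hcard
      linarith
    have hq := mul_le_mul_of_nonneg_right hk1 hp
    have hr : 2 / ε * (ε * (Fintype.card V : ℝ) - 1) = 2 * (Fintype.card V : ℝ) - 2 / ε := by
      field_simp
    linarith
  obtain ⟨i, j, hij, hjk, w, hwi, hwj⟩ := hex
  simp only [T, Finset.mem_erase, Finset.mem_filter, Finset.mem_univ, true_and] at hwi hwj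
  obtain ⟨hwb, hEi⟩ := hwi
  obtain ⟨-, hEj⟩ := hwj
  have d1 := hd i j hij hjk.le
  have d2 := hd i k (hij.trans hjk) le_rfl
  have d3 := C5aux_distinct (h3 _ hEi)
  have d4 := C5aux_distinct (h3 _ hEj)
  have e1 := hE i j hij hjk.le
  have e2 := hE i k (hij.trans hjk) le_rfl
  obtain ⟨p1, p2, p3⟩ := d1
  obtain ⟨q1, q2, q3⟩ := d2
  obtain ⟨r1, r2, r3⟩ := d3
  obtain ⟨s1, s2, s3⟩ := d4
  let f : Fin 5 → V := ![w, c j, b i, c i, c k]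
  refine ⟨(f : Fin 5 → V), ?_, ?_⟩
  · change ∀ x y : Fin 5, f x = f y → x = y
    intro x y
    fin_cases x <;> fin_cases y <;> simp [f] <;> grind
  · change ∀ x : Fin 5, x ≠ 0 → ({f x, f (x + 1), f (x + 2)} : Finset V) ∈ E
    have perm : ∀ A B : Finset V, A ∈ E → (∀ x, x ∈ B ↔ x ∈ A) → B ∈ E := by
      intro A B hA hAB
      rwa [Finset.ext hAB]
    intro x hx
    fin_cases x
    · exact absurd rfl hx
    · refine perm _ ({c j, b i, c i} : Finset V) e1 fun x => ?_
      simp only [Finset.mem_insert, Finset.mem_singleton]; tauto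
    · refine perm _ ({b i, c i, c k} : Finset V) e2 fun x => ?_
      simp only [Finset.mem_insert, Finset.mem_singleton]; tauto
    · refine perm _ ({c i, c k, w} : Finset V) hEi fun x => ?_
      simp only [Finset.mem_insert, Finset.mem_singleton]; tauto
    · refine perm _ ({c k, w, c j} : Finset V) hEj fun x => ?_
      simp only [Finset.mem_insert, Finset.mem_singleton]; tauto
end

section
/- For every ε ∈ (0,1) and every integer ℓ ≥ 5, there exists n₀ such that every 3-uniform hypergraph H on n ≥ n₀ vertices with minimum codegree δ₂(H) ≥ εn contains a copy of Cₗ⁻, the tight cycle on ℓ vertices minus one edge. -/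
section Aux
open Finset
open scoped Classical in
lemma popular {α β : Type*} (A : Finset α) (B : Finset β) (R : α → β → Prop) (c : ℝ)
    (h : c * A.card * B.card ≤ ∑ a ∈ A, ((B.filter (R a)).card : ℝ)) (hB : B.Nonempty) :
    c / 2 * A.card ≤ ((A.filter fun a => c / 2 * B.card ≤ ((B.filter (R a)).card : ℝ)).card : ℝ) := by
  set A' := A.filter fun a => c / 2 * B.card ≤ ((B.filter (R a)).card : ℝ) with hA'
  have hBp : (0 : ℝ) < B.card := by exact_mod_cast hB.card_pos
  by_cases hc : 0 ≤ c
  swap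
  · have : c / 2 * A.card ≤ 0 := mul_nonpos_of_nonpos_of_nonneg (by linarith) (by positivity)
    exact this.trans (by positivity)
  have h1 : ∑ a ∈ A, ((B.filter (R a)).card : ℝ) ≤
      ∑ a ∈ A, ((if c / 2 * B.card ≤ ((B.filter (R a)).card : ℝ) then (B.card : ℝ) else 0)
        + c / 2 * B.card) := by
    apply Finset.sum_le_sum
    intro a _
    split_ifs with h2
    · have : ((B.filter (R a)).card : ℝ) ≤ B.card := by exact_mod_cast card_filter_le _ _
      have : 0 ≤ c / 2 * B.card := by positivity
      linarith
    · push Not at h2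
      linarith
  rw [Finset.sum_add_distrib, ← Finset.sum_filter, sum_const, sum_const, nsmul_eq_mul, nsmul_eq_mul,
    ← hA'] at h1
  have h2 : (c / 2 * A.card) * B.card ≤ A'.card * B.card := by nlinarith
  exact le_of_mul_le_mul_right h2 hBp

open scoped Classical in
lemma sum_swap {α β : Type*} (A : Finset α) (B : Finset β) (R : α → β → Prop) :
    ∑ a ∈ A, ((B.filter (R a)).card : ℝ) = ∑ b ∈ B, ((A.filter fun a => R a b).card : ℝ) := by
  simp only [card_filter]
  push_cast
  exact Finset.sum_comm

open scoped Classical in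
lemma fiber {α β : Type*} (A : Finset α) (U : Finset β) (R : α → β → Prop) (c : ℝ) (hc : 0 < c)
    (hA : A.Nonempty) (hU : U.Nonempty)
    (h : c * A.card * U.card ≤ ∑ a ∈ A, ((U.filter (R a)).card : ℝ)) :
    ∃ U' ⊆ U, ∃ P ⊆ A, c / 2 * U.card ≤ (U'.card : ℝ) ∧
      c / 2 / 2 ^ U.card * A.card ≤ (P.card : ℝ) ∧ ∀ a ∈ P, ∀ u ∈ U', R a u := by
  have hp := popular A U R c h hU
  set A' := A.filter fun a => c / 2 * U.card ≤ ((U.filter (R a)).card : ℝ) with hA'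
  have hAp : (0 : ℝ) < A.card := by exact_mod_cast hA.card_pos
  have hA'p : (0 : ℝ) < A'.card := lt_of_lt_of_le (by positivity) hp
  obtain ⟨U', hU', hle⟩ := Finset.exists_le_card_fiber_of_nsmul_le_card_of_maps_to
      (s := A') (t := U.powerset) (f := fun a => U.filter (R a))
      (b := (A'.card : ℝ) / 2 ^ U.card)
      (fun a _ => mem_powerset.2 (filter_subset _ _)) ⟨∅, by simp⟩ (by
        rw [card_powerset, nsmul_eq_mul]; push_cast
        rw [mul_div_cancel₀]; positivity)
  refine ⟨U', mem_powerset.1 hU', A.filter fun a => ∀ u ∈ U', R a u, filter_subset _ _, ?_, ?_,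
    fun a ha => (mem_filter.1 ha).2⟩
  · have : (0 : ℝ) < ((A'.filter fun a => U.filter (R a) = U').card : ℝ) :=
      lt_of_lt_of_le (by positivity) hle
    have : 0 < (A'.filter fun a => U.filter (R a) = U').card := by exact_mod_cast this
    obtain ⟨a, ha⟩ := card_pos.1 this
    rw [mem_filter, hA', mem_filter] at ha
    rw [← ha.2]
    exact ha.1.2
  · have h1 : ((A'.filter fun a => U.filter (R a) = U').card : ℝ) ≤
        ((A.filter fun a => ∀ u ∈ U', R a u).card : ℝ) := by
      norm_cast
      apply card_le_card
      intro a ha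
      rw [mem_filter, hA', mem_filter] at ha
      rw [mem_filter]
      refine ⟨ha.1.1, fun u hu => ?_⟩
      rw [← ha.2] at hu
      exact (mem_filter.1 hu).2
    refine le_trans ?_ (hle.trans h1)
    rw [div_mul_eq_mul_div]
    gcongr

open scoped Classical in
/-- Abstract symmetric ternary relation with large codegrees. -/
def GoodRel (ε : ℝ) (V : Type) [Fintype V] (G : V → V → V → Prop) : Prop :=
  (∀ x y z, G x y z → G y x z) ∧ (∀ x y z, G x y z → G x z y) ∧ (∀ x y z, G x y z → x ≠ y) ∧
    ∀ u v, u ≠ v → ε * (Fintype.card V : ℝ) ≤ ((univ.filter fun w => G u v w).card : ℝ)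

lemma step (ε c : ℝ) (hε : 0 < ε) (hc : 0 < c) (s t : ℕ) :
    ∃ c' : ℝ, 0 < c' ∧ ∃ n₀ : ℕ, ∀ (V : Type) [Fintype V] (G : V → V → V → Prop),
      GoodRel ε V G → n₀ ≤ Fintype.card V → ∀ S : Finset V, c * Fintype.card V ≤ S.card →
      ∃ X T S' : Finset V, X ⊆ S ∧ S' ⊆ S ∧ X.card = s ∧ t ≤ T.card ∧
        c' * Fintype.card V ≤ S'.card ∧ ∀ x ∈ X, ∀ b ∈ T, ∀ y ∈ S', G x b y := by
  classical
  obtain ⟨w, hw⟩ := exists_nat_gt (2 * s / ε)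
  have hw0 : 0 < w := by
    have : (0 : ℝ) < w := lt_of_le_of_lt (by positivity) hw
    exact_mod_cast this
  have hws : (s : ℝ) ≤ ε / 2 * w := by
    rw [div_lt_iff₀ hε] at hw; linarith
  obtain ⟨c₁, hc₁⟩ : ∃ c₁ : ℝ, c₁ = ε / 2 / 2 ^ w := ⟨_, rfl⟩
  have hc₁p : 0 < c₁ := by rw [hc₁]; positivity
  obtain ⟨w', hw'⟩ := exists_nat_gt (4 * t / c₁)
  have hw'0 : 0 < w' := by
    have : (0 : ℝ) < w' := lt_of_le_of_lt (by positivity) hw'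
    exact_mod_cast this
  have hwt : (t : ℝ) ≤ c₁ / 2 / 2 * w' := by
    rw [div_lt_iff₀ hc₁p] at hw'; linarith
  obtain ⟨n₁, hn₁⟩ := exists_nat_gt (2 * w / c)
  obtain ⟨n₂, hn₂⟩ := exists_nat_gt (2 * w' / c₁)
  refine ⟨c₁ / 2 / 2 / 2 ^ w' * (c / 2), by positivity, max n₁ n₂, ?_⟩
  rintro V _ G ⟨hs1, hs2, hne, hcod⟩ hn S hS
  have hn1 : (n₁ : ℝ) ≤ Fintype.card V := by exact_mod_cast (le_max_left _ _).trans hn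
  have hn2 : (n₂ : ℝ) ≤ Fintype.card V := by exact_mod_cast (le_max_right _ _).trans hn
  rw [div_lt_iff₀ hc] at hn₁
  rw [div_lt_iff₀ hc₁p] at hn₂
  have hb1 : 2 * (w : ℝ) ≤ c * Fintype.card V := by nlinarith
  have hb2 : (w' : ℝ) ≤ c₁ / 2 * Fintype.card V := by nlinarith
  have hw0' : (0 : ℝ) < w := by exact_mod_cast hw0
  have hVp : (0 : ℝ) < Fintype.card V := by
    by_contra hcon
    nlinarith
  have hVne : (univ : Finset V).Nonempty := by
    rw [← card_pos, card_univ]; exact_mod_cast hVp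
  have hwS : w ≤ S.card := by
    have : (w : ℝ) ≤ S.card := by linarith
    exact_mod_cast this
  obtain ⟨W, hWS, hW⟩ := exists_subset_card_eq hwS
  have hWne : W.Nonempty := by rw [← card_pos, hW]; exact hw0
  have hAcard : ((S \ W).card : ℝ) = S.card - w := by
    rw [card_sdiff_of_subset hWS, hW, Nat.cast_sub hwS]
  have hA : c / 2 * Fintype.card V ≤ ((S \ W).card : ℝ) := by rw [hAcard]; linarith
  have hAp : (0 : ℝ) < ((S \ W).card : ℝ) := lt_of_lt_of_le (by positivity) hA
  obtain ⟨A, hAdef⟩ : ∃ A, A = S \ W := ⟨_, rfl⟩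
  rw [← hAdef] at hA hAp
  have hAne : A.Nonempty := by rw [← card_pos]; exact_mod_cast hAp
  obtain ⟨U', hU'W, P, hPA, hU'c, hP, hPR⟩ := fiber (A ×ˢ (univ : Finset V)) W
    (fun p x => G x p.2 p.1) ε hε (hAne.product hVne) hWne (by
      rw [sum_swap, card_product]
      have : ∀ x ∈ W, ε * A.card * Fintype.card V ≤
          ((((A ×ˢ (univ : Finset V)).filter fun p => G x p.2 p.1).card : ℕ) : ℝ) := by
        intro x hx
        rw [card_filter, sum_product]
        simp only [← card_filter]
        push_cast
        have : ∑ y ∈ A, ε * (Fintype.card V : ℝ) ≤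
            ∑ y ∈ A, ((univ.filter fun b => G x b y).card : ℝ) := by
          apply sum_le_sum
          intro y hy
          have hxy : x ≠ y := by
            rintro rfl
            rw [hAdef, mem_sdiff] at hy
            exact hy.2 hx
          refine (hcod x y hxy).trans ?_
          norm_cast
          apply card_le_card
          intro b hb
          rw [mem_filter] at hb ⊢
          exact ⟨hb.1, hs2 _ _ _ hb.2⟩
        rw [sum_const, nsmul_eq_mul] at this
        linarith
      have h2 := sum_le_sum this
      rw [sum_const, nsmul_eq_mul] at h2
      push_cast
      rw [card_univ]
      linarith)
  rw [hW, ← hc₁] at hP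
  rw [hW] at hU'c
  have hsU : s ≤ U'.card := by
    have : (s : ℝ) ≤ U'.card := hws.trans hU'c
    exact_mod_cast this
  obtain ⟨X, hXU, hX⟩ := exists_subset_card_eq hsU
  obtain ⟨R, hR⟩ : ∃ R : V → V → Prop, ∀ b y, R b y ↔ (y, b) ∈ P := ⟨_, fun _ _ => Iff.rfl⟩
  have hPf : P = (A ×ˢ (univ : Finset V)).filter fun p => R p.2 p.1 := by
    ext p
    rw [mem_filter, hR]
    exact ⟨fun h => ⟨hPA h, h⟩, fun h => h.2⟩
  have hP2 : c₁ * (univ : Finset V).card * A.card ≤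
      ∑ b ∈ (univ : Finset V), ((A.filter fun y => R b y).card : ℝ) := by
    rw [← sum_swap A univ (fun y b => R b y)]
    rw [hPf, card_filter, sum_product] at hP
    simp only [← card_filter] at hP
    rw [card_product] at hP
    push_cast at hP
    linarith
  have hpop := popular (univ : Finset V) A (fun b y => R b y) c₁ hP2 hAne
  rw [card_univ] at hpop
  have hpop' := hb2.trans hpop
  obtain ⟨W', hW'sub, hW'⟩ := exists_subset_card_eq (Nat.cast_le.1 hpop')
  have hW'ne : W'.Nonempty := by rw [← card_pos, hW']; exact hw'0
  obtain ⟨T, hTW, S', hS'A, hTc, hS', hSR⟩ := fiber A W' (fun y b => R b y) (c₁ / 2) (by positivity)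
    hAne hW'ne (by
      rw [sum_swap]
      have : ∀ b ∈ W', c₁ / 2 * A.card ≤ ((A.filter fun y => R b y).card : ℝ) := by
        intro b hb
        exact (mem_filter.1 (hW'sub hb)).2
      have h2 := sum_le_sum this
      rw [sum_const, nsmul_eq_mul] at h2
      linarith)
  rw [hW'] at hTc hS'
  refine ⟨X, T, S', ?_, ?_, hX, ?_, ?_, ?_⟩
  · exact hXU.trans (hU'W.trans hWS)
  · refine hS'A.trans ?_
    rw [hAdef]
    exact sdiff_subset
  · have : (t : ℝ) ≤ T.card := hwt.trans hTc
    exact_mod_cast this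
  · refine le_trans ?_ hS'
    rw [mul_assoc]
    gcongr
  · intro x hx b hb y hy
    exact hPR _ ((hR _ _).1 (hSR y hy b hb)) x (hXU hx)

lemma chain (ε : ℝ) (hε : 0 < ε) (s t m : ℕ) :
    ∃ c : ℝ, 0 < c ∧ ∃ n₀ : ℕ, ∀ (V : Type) [Fintype V] (G : V → V → V → Prop),
      GoodRel ε V G → n₀ ≤ Fintype.card V →
      ∃ (X T : ℕ → Finset V) (S : Finset V), c * Fintype.card V ≤ S.card ∧
        ∀ i < m, (X i).card = s ∧ t ≤ (T i).card ∧ ∀ x ∈ X i, ∀ b ∈ T i,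
          (∀ y ∈ S, G x b y) ∧ ∀ j, i < j → j < m → ∀ y ∈ X j, G x b y := by
  classical
  induction m with
  | zero =>
    refine ⟨1, one_pos, 0, ?_⟩
    intro V _ G _ _
    exact ⟨fun _ => ∅, fun _ => ∅, univ, by simp, by simp⟩
  | succ m ih =>
    obtain ⟨c, hc, n₁, h1⟩ := ih
    obtain ⟨c', hc', n₂, h2⟩ := step ε c hε hc s t
    refine ⟨c', hc', max n₁ n₂, ?_⟩
    intro V _ G hG hn
    obtain ⟨X, T, S, hS, hX⟩ := h1 V G hG ((le_max_left _ _).trans hn)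
    obtain ⟨X', T', S', hX'S, hS'S, hX'c, hT'c, hS', hE⟩ := 
      h2 V G hG ((le_max_right _ _).trans hn) S hS
    refine ⟨fun i => if i = m then X' else X i, fun i => if i = m then T' else T i, S', hS', ?_⟩
    intro i hi
    by_cases him : i = m
    · simp only [him, if_true]
      refine ⟨hX'c, hT'c, fun x hx b hb => ⟨hE x hx b hb, ?_⟩⟩
      intro j hj hj'
      omega
    · simp only [him, if_false]
      obtain ⟨ha, hb, hc⟩ := hX i (by omega)
      refine ⟨ha, hb, fun x hx b hb => ⟨fun y hy => (hc x hx b hb).1 y (hS'S hy), ?_⟩⟩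
      intro j hj hj' y hy
      by_cases hjm : j = m
      · simp only [hjm, if_true] at hy
        exact (hc x hx b hb).1 y (hX'S hy)
      · simp only [hjm, if_false] at hy
        exact (hc x hx b hb).2 j hj (by omega) y hy

lemma blowup (ε : ℝ) (hε : 0 < ε) (t : ℕ) :
    ∃ n₀ : ℕ, ∀ (V : Type) [Fintype V] (G : V → V → V → Prop),
      GoodRel ε V G → n₀ ≤ Fintype.card V →
      ∃ (a e : V) (B C D : Finset V), t ≤ B.card ∧ t ≤ C.card ∧ t ≤ D.card ∧ e ∉ B ∧
        ∀ b ∈ B, ∀ c ∈ C, ∀ d ∈ D, G a b c ∧ G b c d ∧ G c d e ∧ G d e a := by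
  classical
  obtain ⟨m, hm⟩ := exists_nat_gt (4 / ε)
  rw [div_lt_iff₀ hε] at hm
  have hm0 : 0 < m := by
    rcases Nat.eq_zero_or_pos m with h | h
    · subst h; norm_num at hm
    · exact h
  obtain ⟨s, hs⟩ : ∃ s, s = m * t + 1 := ⟨_, rfl⟩
  obtain ⟨c, hc, n₁, h1⟩ := chain ε hε s (t + 1) m
  obtain ⟨c₂, hc₂⟩ : ∃ c₂ : ℝ, c₂ = ε / 2 / 2 ^ (m * s) := ⟨_, rfl⟩
  have hc₂p : 0 < c₂ := by rw [hc₂]; positivity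
  obtain ⟨n₂, hn₂⟩ := exists_nat_gt (t / (c₂ / 2 * c))
  rw [div_lt_iff₀ (by positivity)] at hn₂
  refine ⟨max (max n₁ n₂) 1, ?_⟩
  intro V _ G hG hn
  obtain ⟨X, T, S, hS, hX⟩ := h1 V G hG (by omega)
  obtain ⟨hs1, hs2, hne, hcod⟩ := hG
  have hn2 : (n₂ : ℝ) ≤ Fintype.card V := by
    have : n₂ ≤ Fintype.card V := by omega
    exact_mod_cast this
  have hVp' : 0 < Fintype.card V := by omega
  have hVp : (0 : ℝ) < Fintype.card V := by exact_mod_cast hVp'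
  have hVne : (univ : Finset V).Nonempty := by
    rw [← card_pos, card_univ]; exact hVp'
  have hSp : (0 : ℝ) < S.card := lt_of_lt_of_le (by positivity) hS
  have hSne : S.Nonempty := by rw [← card_pos]; exact_mod_cast hSp
  have hTne : ∀ i < m, ∃ b, b ∈ T i := by
    intro i hi
    have := (hX i hi).2.1
    exact card_pos.1 (by omega)
  have hdisj : ∀ i < m, ∀ j < m, i < j → Disjoint (X i) (X j) := by
    intro i hi j hj hij
    rw [Finset.disjoint_left]
    intro x hx hx'
    obtain ⟨b, hb⟩ := hTne i hi
    have := ((hX i hi).2.2 x hx b hb).2 j hij hj x hx'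
    exact hne _ _ _ (hs2 _ _ _ this) rfl
  obtain ⟨U, hU⟩ : ∃ U, U = (range m).biUnion X := ⟨_, rfl⟩
  have hUc : U.card = m * s := by
    rw [hU, card_biUnion]
    · rw [sum_congr rfl (fun i hi => (hX i (mem_range.1 hi)).1)]
      simp
    · intro i hi j hj hij
      rcases lt_or_gt_of_ne hij with h | h
      · exact hdisj i (mem_range.1 hi) j (mem_range.1 hj) h
      · exact (hdisj j (mem_range.1 hj) i (mem_range.1 hi) h).symm
  have hUne : U.Nonempty := by
    rw [← card_pos, hUc, hs]; positivity
  obtain ⟨U', hU'U, P, hPA, hU'c, hP, hPR⟩ := fiber ((univ : Finset V) ×ˢ S) U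
    (fun p x => G x p.2 p.1) ε hε (hVne.product hSne) hUne (by
      rw [sum_swap, card_product]
      have : ∀ x ∈ U, ε * Fintype.card V * S.card ≤
          (((((univ : Finset V) ×ˢ S).filter fun p => G x p.2 p.1).card : ℕ) : ℝ) := by
        intro x hx
        rw [card_filter, sum_product_right]
        simp only [← card_filter]
        push_cast
        have : ∑ y ∈ S, ε * (Fintype.card V : ℝ) ≤
            ∑ y ∈ S, ((univ.filter fun b => G x y b).card : ℝ) := by
          apply sum_le_sum
          intro y hy
          apply hcod
          rw [hU, mem_biUnion] at hx
          obtain ⟨i, hi, hx⟩ := hx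
          rw [mem_range] at hi
          obtain ⟨b, hb⟩ := hTne i hi
          exact hne _ _ _ (hs2 _ _ _ (((hX i hi).2.2 x hx b hb).1 y hy))
        rw [sum_const, nsmul_eq_mul] at this
        linarith
      have h2 := sum_le_sum this
      rw [sum_const, nsmul_eq_mul] at h2
      push_cast
      rw [card_univ]
      linarith)
  rw [hUc, ← hc₂] at hP
  rw [hUc] at hU'c
  obtain ⟨R, hR⟩ : ∃ R : V → V → Prop, ∀ e d, R e d ↔ (e, d) ∈ P := ⟨_, fun _ _ => Iff.rfl⟩
  have hPf : P = ((univ : Finset V) ×ˢ S).filter fun p => R p.1 p.2 := by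
    ext p
    rw [mem_filter, hR]
    exact ⟨fun h => ⟨hPA h, h⟩, fun h => h.2⟩
  have hP2 : c₂ * (univ : Finset V).card * S.card ≤
      ∑ e ∈ (univ : Finset V), ((S.filter fun d => R e d).card : ℝ) := by
    rw [hPf, card_filter, sum_product] at hP
    simp only [← card_filter] at hP
    rw [card_product] at hP
    push_cast at hP
    linarith
  have hpop := popular (univ : Finset V) S (fun e d => R e d) c₂ hP2 hSne
  rw [card_univ] at hpop
  have hpop' := lt_of_lt_of_le (by positivity) hpop
  obtain ⟨e, he⟩ := card_pos.1 (Nat.cast_pos.1 hpop')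
  rw [mem_filter] at he
  have he := he.2
  have hbig : s + m * t < U'.card := by
    have h3 : (2 : ℝ) * s ≤ U'.card := by
      push_cast at hU'c
      have : (0 : ℝ) ≤ s := by positivity
      nlinarith
    have h3' : 2 * s ≤ U'.card := by exact_mod_cast h3
    omega
  have hsum : U'.card ≤ ∑ i ∈ range m, (X i ∩ U').card := by
    refine le_trans (card_le_card ?_) card_biUnion_le
    intro x hx
    have := hU'U hx
    rw [hU, mem_biUnion] at this
    obtain ⟨i, hi, hxi⟩ := this
    exact mem_biUnion.2 ⟨i, hi, mem_inter.2 ⟨hxi, hx⟩⟩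
  obtain ⟨i, j, hij, hj, hi', hj'⟩ : ∃ i j, i < j ∧ j < m ∧ t ≤ (X i ∩ U').card ∧
      (X j ∩ U').Nonempty := by
    by_contra hcon
    push Not at hcon
    have key : ∀ k ≤ m, ∑ i ∈ range k, (X i ∩ U').card ≤ s + k * t := by
      intro k hk
      induction k with
      | zero => simp
      | succ k ih =>
        rw [sum_range_succ]
        by_cases hex : ∃ i < k, t ≤ (X i ∩ U').card
        · obtain ⟨i, hi, hit⟩ := hex
          have := hcon i k hi (by omega) hit
          rw [this, card_empty]
          have := ih (by omega)
          nlinarith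
        · push Not at hex
          have h5 : ∑ i ∈ range k, (X i ∩ U').card ≤ ∑ i ∈ range k, t :=
            sum_le_sum fun i hi => (hex i (mem_range.1 hi)).le
          rw [sum_const, card_range, smul_eq_mul] at h5
          have h6 : (X k ∩ U').card ≤ s := by
            rw [← (hX k (by omega)).1]
            exact card_le_card inter_subset_left
          nlinarith
    have := key m le_rfl
    omega
  obtain ⟨a, ha⟩ := hj'
  rw [mem_inter] at ha
  obtain ⟨hXc, hTc, hXX⟩ := hX i (by omega)
  refine ⟨a, e, (T i).erase e, X i ∩ U', S.filter fun d => R e d, ?_, hi', ?_,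
    by simp, ?_⟩
  · have := pred_card_le_card_erase (a := e) (s := T i)
    omega
  · have : (t : ℝ) ≤ ((S.filter fun d => R e d).card : ℝ) := by
      refine le_trans ?_ he
      have : c₂ / 2 * (c * Fintype.card V) ≤ c₂ / 2 * S.card := by gcongr
      have : (n₂ : ℝ) * (c₂ / 2 * c) ≤ Fintype.card V * (c₂ / 2 * c) := by gcongr
      linarith
    exact_mod_cast this
  · intro b hb c hc d hd
    rw [mem_erase] at hb
    rw [mem_inter] at hc
    rw [mem_filter] at hd
    have h7 := hXX c hc.1 b hb.2
    have e1 := h7.2 j hij hj a ha.1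
    have e2 := h7.1 d hd.1
    have e3 := hPR _ ((hR _ _).1 hd.2) c hc.2
    have e4 := hPR _ ((hR _ _).1 hd.2) a ha.2
    refine ⟨?_, hs1 _ _ _ e2, e3, ?_⟩
    · exact hs1 _ _ _ (hs2 _ _ _ (hs1 _ _ _ (hs2 _ _ _ (hs2 _ _ _ e1)))) 
    · exact hs2 _ _ _ (hs1 _ _ _ e4)

lemma enum_of_card {V : Type} (B : Finset V) (ℓ : ℕ) (hℓ : 0 < ℓ) (h : ℓ ≤ B.card) :
    ∃ b : ℕ → V, (∀ k, b k ∈ B) ∧ ∀ i < ℓ, ∀ j < ℓ, b i = b j → i = j := by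
  refine ⟨fun k => (B.equivFin.symm ⟨k % ℓ, (Nat.mod_lt _ hℓ).trans_le h⟩ : V), fun k => by simp, ?_⟩
  intro i hi j hj hij
  have h1 := B.equivFin.symm.injective (Subtype.ext hij)
  rw [Fin.mk.injEq, Nat.mod_eq_of_lt hi, Nat.mod_eq_of_lt hj] at h1
  exact h1

lemma cycle_of_seq {V : Type} (G : V → V → V → Prop) (ℓ : ℕ) (hℓ : 5 ≤ ℓ) (g : ℕ → V)
    (hinj : ∀ i < ℓ, ∀ j < ℓ, g i = g j → i = j)
    (h1 : ∀ k, k + 2 < ℓ → G (g k) (g (k + 1)) (g (k + 2)))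
    (h2 : G (g (ℓ - 2)) (g (ℓ - 1)) (g 0)) :
    ∃ f : ZMod ℓ → V, Function.Injective f ∧ ∀ i : ZMod ℓ, i ≠ 0 → G (f i) (f (i + 1)) (f (i + 2)) := by
  have : NeZero ℓ := ⟨by omega⟩
  refine ⟨fun z => g (z - 1).val, ?_, ?_⟩
  · intro x y hxy
    have := hinj _ (ZMod.val_lt _) _ (ZMod.val_lt _) hxy
    have := ZMod.val_injective ℓ this
    exact sub_left_injective this
  · intro i hi
    obtain ⟨k, hk, hik⟩ : ∃ k < ℓ, i = (k : ZMod ℓ) + 1 :=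
      ⟨(i - 1).val, ZMod.val_lt _, by rw [ZMod.natCast_zmod_val]; ring⟩
    have hk1 : k + 1 < ℓ := by
      by_contra hcon
      apply hi
      have : k + 1 = ℓ := by omega
      rw [hik]
      have h3 : ((k + 1 : ℕ) : ZMod ℓ) = 0 := by rw [this]; simp
      simpa using h3
    have e0 : (i - 1).val = k := by
      rw [hik, add_sub_cancel_right, ZMod.val_natCast_of_lt hk]
    have e1 : (i + 1 - 1).val = k + 1 := by
      have : i + 1 - 1 = ((k + 1 : ℕ) : ZMod ℓ) := by rw [hik]; push_cast; ring
      rw [this, ZMod.val_natCast_of_lt hk1]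
    have e2' : i + 2 - 1 = ((k + 2 : ℕ) : ZMod ℓ) := by rw [hik]; push_cast; ring
    simp only [e0, e1]
    by_cases hk2 : k + 2 < ℓ
    · rw [e2', ZMod.val_natCast_of_lt hk2]
      exact h1 k hk2
    · have h4 : k + 2 = ℓ := by omega
      have h5 : k = ℓ - 2 := by omega
      have h6 : k + 1 = ℓ - 1 := by omega
      rw [e2', h4, h6, h5]
      simpa using h2

set_option maxHeartbeats 2000000 in
lemma seq_of_blowup {V : Type} (G : V → V → V → Prop) (ℓ : ℕ) (hℓ : 5 ≤ ℓ)
    (hs1 : ∀ x y z, G x y z → G y x z) (hs2 : ∀ x y z, G x y z → G x z y)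
    (hne : ∀ x y z, G x y z → x ≠ y) (a e : V) (b c d : ℕ → V)
    (hb : ∀ i < ℓ, ∀ j < ℓ, b i = b j → i = j) (hc : ∀ i < ℓ, ∀ j < ℓ, c i = c j → i = j)
    (hd : ∀ i < ℓ, ∀ j < ℓ, d i = d j → i = j) (heb : ∀ i, e ≠ b i)
    (hG : ∀ i j k, G a (b i) (c j) ∧ G (b i) (c j) (d k) ∧ G (c j) (d k) e ∧ G (d k) e a) :
    ∃ g : ℕ → V, (∀ i < ℓ, ∀ j < ℓ, g i = g j → i = j) ∧
      (∀ k, k + 2 < ℓ → G (g k) (g (k + 1)) (g (k + 2))) ∧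
      G (g (ℓ - 2)) (g (ℓ - 1)) (g 0) := by
  have nab : ∀ i, a ≠ b i := fun i => hne _ _ _ (hG i 0 0).1
  have nac : ∀ i, a ≠ c i := fun i => hne _ _ _ (hs2 _ _ _ (hG 0 i 0).1)
  have nad : ∀ i, a ≠ d i := fun i => (hne _ _ _ (hs2 _ _ _ (hG 0 0 i).2.2.2)).symm
  have nea : e ≠ a := hne _ _ _ (hs2 _ _ _ (hs1 _ _ _ (hG 0 0 0).2.2.2))
  have nbc : ∀ i j, b i ≠ c j := fun i j => hne _ _ _ (hG i j 0).2.1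
  have nbd : ∀ i j, b i ≠ d j := fun i j => hne _ _ _ (hs2 _ _ _ (hG i 0 j).2.1)
  have ncd : ∀ i j, c i ≠ d j := fun i j => hne _ _ _ (hG 0 i j).2.2.1
  have nec : ∀ i, e ≠ c i := fun i => (hne _ _ _ (hs2 _ _ _ (hG 0 i 0).2.2.1)).symm
  have ned : ∀ i, e ≠ d i := fun i => (hne _ _ _ (hG 0 0 i).2.2.2).symm
  have A1 : ∀ i j, G a (b i) (c j) := fun i j => (hG i j 0).1
  have A2 : ∀ i j k, G (b i) (c j) (d k) := fun i j k => (hG i j k).2.1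
  have A3 : ∀ j k, G (c j) (d k) e := fun j k => (hG 0 j k).2.2.1
  have A4 : ∀ k, G (d k) e a := fun k => (hG 0 0 k).2.2.2
  have A2' : ∀ i j k, G (c j) (d k) (b i) := fun i j k => hs2 _ _ _ (hs1 _ _ _ (A2 i j k))
  have A2'' : ∀ i j k, G (d k) (b i) (c j) := fun i j k => hs1 _ _ _ (hs2 _ _ _ (A2 i j k))
  have hmod : ℓ % 3 = 0 ∨ ℓ % 3 = 2 ∨ ℓ % 3 = 1 := by omega
  rcases hmod with h | h | h
  · refine ⟨fun k => if k % 3 = 0 then b k else if k % 3 = 1 then c k else d k, ?_, ?_, ?_⟩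
    · intro i hi j hj hij
      dsimp only at hij
      split_ifs at hij <;>
        first
          | omega | exact hb i hi j hj hij | exact hc i hi j hj hij | exact hd i hi j hj hij
          | exact absurd hij (nab _) | exact absurd hij.symm (nab _)
          | exact absurd hij (nac _) | exact absurd hij.symm (nac _)
          | exact absurd hij (nad _) | exact absurd hij.symm (nad _)
          | exact absurd hij (nea) | exact absurd hij.symm (nea)
          | exact absurd hij (nbc _ _) | exact absurd hij.symm (nbc _ _)
          | exact absurd hij (nbd _ _) | exact absurd hij.symm (nbd _ _)
          | exact absurd hij (ncd _ _) | exact absurd hij.symm (ncd _ _)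
          | exact absurd hij (nec _) | exact absurd hij.symm (nec _)
          | exact absurd hij (ned _) | exact absurd hij.symm (ned _)
          | exact absurd hij (heb _) | exact absurd hij.symm (heb _)
    · intro k hk
      have : k % 3 = 0 ∨ k % 3 = 1 ∨ k % 3 = 2 := by omega
      rcases this with h' | h' | h'
      · simp [h', show (k + 1) % 3 = 1 by omega, show (k + 2) % 3 = 2 by omega, A2]
      · simp [h', show (k + 1) % 3 = 2 by omega, show (k + 2) % 3 = 0 by omega, A2']
      · simp [h', show (k + 1) % 3 = 0 by omega, show (k + 2) % 3 = 1 by omega, A2'']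
    · simp [show (ℓ - 2) % 3 = 1 by omega, show (ℓ - 1) % 3 = 2 by omega, A2']
  · refine ⟨fun k => if k = 0 then a else if k = ℓ - 1 then e else
      if k % 3 = 1 then b k else if k % 3 = 2 then c k else d k, ?_, ?_, ?_⟩
    · intro i hi j hj hij
      dsimp only at hij
      split_ifs at hij <;>
        first
          | omega | exact hb i hi j hj hij | exact hc i hi j hj hij | exact hd i hi j hj hij
          | exact absurd hij (nab _) | exact absurd hij.symm (nab _)
          | exact absurd hij (nac _) | exact absurd hij.symm (nac _)
          | exact absurd hij (nad _) | exact absurd hij.symm (nad _)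
          | exact absurd hij (nea) | exact absurd hij.symm (nea)
          | exact absurd hij (nbc _ _) | exact absurd hij.symm (nbc _ _)
          | exact absurd hij (nbd _ _) | exact absurd hij.symm (nbd _ _)
          | exact absurd hij (ncd _ _) | exact absurd hij.symm (ncd _ _)
          | exact absurd hij (nec _) | exact absurd hij.symm (nec _)
          | exact absurd hij (ned _) | exact absurd hij.symm (ned _)
          | exact absurd hij (heb _) | exact absurd hij.symm (heb _)
    · intro k hk
      obtain ⟨g, hg⟩ : ∃ g : ℕ → V, g = fun k => if k = 0 then a else if k = ℓ - 1 then e else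
        if k % 3 = 1 then b k else if k % 3 = 2 then c k else d k := ⟨_, rfl⟩
      rw [← hg]
      have g0 : g 0 = a := by simp [hg]
      have ge : ∀ k, k = ℓ - 1 → g k = e := fun k h1 => by
        simp only [hg]; rw [if_neg (by omega), if_pos h1]
      have gb : ∀ k, k ≠ ℓ - 1 → k % 3 = 1 → g k = b k := fun k h1 h2 => by
        simp only [hg]; rw [if_neg (by omega), if_neg h1, if_pos h2]
      have gc : ∀ k, k ≠ ℓ - 1 → k % 3 = 2 → g k = c k := fun k h1 h2 => by
        simp only [hg]; rw [if_neg (by omega), if_neg h1, if_neg (by omega), if_pos h2]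
      have gd : ∀ k, k ≠ 0 → k ≠ ℓ - 1 → k % 3 = 0 → g k = d k := fun k h0 h1 h2 => by
        simp only [hg]; rw [if_neg h0, if_neg h1, if_neg (by omega), if_neg (by omega)]
      by_cases k0 : k = 0
      · subst k0
        rw [g0, gb _ (by omega) (by omega), gc _ (by omega) (by omega)]
        exact A1 _ _
      by_cases k1 : k + 2 = ℓ - 1
      · rw [ge _ k1, gc k (by omega) (by omega), gd _ (by omega) (by omega) (by omega)]
        exact A3 _ _
      have : k % 3 = 0 ∨ k % 3 = 1 ∨ k % 3 = 2 := by omega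
      rcases this with h' | h' | h'
      · rw [gd k (by omega) (by omega) (by omega), gb _ (by omega) (by omega),
          gc _ (by omega) (by omega)]
        exact A2'' _ _ _
      · rw [gb k (by omega) (by omega), gc _ (by omega) (by omega),
          gd _ (by omega) (by omega) (by omega)]
        exact A2 _ _ _
      · rw [gc k (by omega) (by omega), gd _ (by omega) (by omega) (by omega),
          gb _ (by omega) (by omega)]
        exact A2' _ _ _
    · simp only [if_true, if_neg (show ℓ - 2 ≠ 0 by omega), if_neg (show ℓ - 2 ≠ ℓ - 1 by omega),
        if_neg (show ℓ - 1 ≠ 0 by omega), if_neg (show ¬ (ℓ - 2) % 3 = 1 by omega),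
        if_neg (show ¬ (ℓ - 2) % 3 = 2 by omega)]
      exact A4 _
  · refine ⟨fun k => if k = 0 then a else if k = 2 then e else
      if k % 3 = 0 then c k else if k % 3 = 1 then d k else b k, ?_, ?_, ?_⟩
    · intro i hi j hj hij
      dsimp only at hij
      split_ifs at hij <;>
        first
          | omega | exact hb i hi j hj hij | exact hc i hi j hj hij | exact hd i hi j hj hij
          | exact absurd hij (nab _) | exact absurd hij.symm (nab _)
          | exact absurd hij (nac _) | exact absurd hij.symm (nac _)
          | exact absurd hij (nad _) | exact absurd hij.symm (nad _)
          | exact absurd hij (nea) | exact absurd hij.symm (nea)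
          | exact absurd hij (nbc _ _) | exact absurd hij.symm (nbc _ _)
          | exact absurd hij (nbd _ _) | exact absurd hij.symm (nbd _ _)
          | exact absurd hij (ncd _ _) | exact absurd hij.symm (ncd _ _)
          | exact absurd hij (nec _) | exact absurd hij.symm (nec _)
          | exact absurd hij (ned _) | exact absurd hij.symm (ned _)
          | exact absurd hij (heb _) | exact absurd hij.symm (heb _)
    · intro k hk
      obtain ⟨g, hg⟩ : ∃ g : ℕ → V, g = fun k => if k = 0 then a else if k = 2 then e else
        if k % 3 = 0 then c k else if k % 3 = 1 then d k else b k := ⟨_, rfl⟩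
      rw [← hg]
      have g0 : g 0 = a := by simp [hg]
      have g2 : g 2 = e := by simp [hg]
      have gc : ∀ k, k ≠ 0 → k % 3 = 0 → g k = c k := fun k h1 h2 => by
        simp only [hg]; rw [if_neg h1, if_neg (by omega), if_pos h2]
      have gd : ∀ k, k % 3 = 1 → g k = d k := fun k h2 => by
        simp only [hg]; rw [if_neg (by omega), if_neg (by omega), if_neg (by omega), if_pos h2]
      have gb : ∀ k, k ≠ 2 → k % 3 = 2 → g k = b k := fun k h1 h2 => by
        simp only [hg]; rw [if_neg (by omega), if_neg h1, if_neg (by omega), if_neg (by omega)]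
      by_cases k0 : k = 0
      · subst k0
        rw [g0, g2, gd _ (by omega)]
        exact hs1 _ _ _ (hs2 _ _ _ (A4 _))
      by_cases k1 : k = 1
      · subst k1
        rw [gd _ (by omega), g2, gc _ (by omega) (by omega)]
        exact hs2 _ _ _ (hs1 _ _ _ (A3 _ _))
      by_cases k2 : k = 2
      · subst k2
        rw [g2, gc _ (by omega) (by omega), gd _ (by omega)]
        exact hs1 _ _ _ (hs2 _ _ _ (A3 _ _))
      have : k % 3 = 0 ∨ k % 3 = 1 ∨ k % 3 = 2 := by omega
      rcases this with h' | h' | h'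
      · rw [gc k (by omega) (by omega), gd _ (by omega), gb _ (by omega) (by omega)]
        exact A2' _ _ _
      · rw [gd k (by omega), gb _ (by omega) (by omega), gc _ (by omega) (by omega)]
        exact A2'' _ _ _
      · rw [gb k (by omega) (by omega), gc _ (by omega) (by omega), gd _ (by omega)]
        exact A2 _ _ _
    · simp only [if_true, if_neg (show ℓ - 2 ≠ 0 by omega), if_neg (show ℓ - 2 ≠ 2 by omega),
        if_neg (show ℓ - 1 ≠ 0 by omega), if_neg (show ℓ - 1 ≠ 2 by omega),
        if_neg (show ¬ (ℓ - 2) % 3 = 0 by omega), if_neg (show ¬ (ℓ - 2) % 3 = 1 by omega),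
        if_pos (show (ℓ - 1) % 3 = 0 by omega)]
      exact hs2 _ _ _ (hs1 _ _ _ (A1 _ _))

end Aux

/-- For every `ε ∈ (0,1)` and every integer `ℓ ≥ 5` there is `n₀` such
that every 3-uniform hypergraph on `n ≥ n₀` vertices with minimum codegree at least `εn`
contains a copy of `Cₗ⁻`, the tight cycle on `ℓ` vertices minus one edge (here the edge at
index `0`).  In other words, `γ(Cₗ⁻) = 0`. -/
theorem codegree_turan_density_Cl_minus_zero (ε : ℝ) (hε : ε ∈ Set.Ioo (0 : ℝ) 1)
    (ℓ : ℕ) (hℓ : 5 ≤ ℓ) :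
    ∃ n₀ : ℕ, ∀ (V : Type) [Fintype V] [DecidableEq V] (E : Finset (Finset V)),
      (∀ e ∈ E, e.card = 3) → n₀ ≤ Fintype.card V →
      (∀ u v : V, u ≠ v →
        ε * (Fintype.card V : ℝ) ≤ ((E.filter fun e => u ∈ e ∧ v ∈ e).card : ℝ)) →
      ∃ f : ZMod ℓ → V, Function.Injective f ∧
        ∀ i : ZMod ℓ, i ≠ 0 → ({f i, f (i + 1), f (i + 2)} : Finset V) ∈ E := by
  classical
  obtain ⟨n₀, h⟩ := blowup ε hε.1 ℓ
  refine ⟨n₀, ?_⟩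
  intro V _ _ E hE hn hcod
  have hne : ∀ x y z : V, ({x, y, z} : Finset V) ∈ E → x ≠ y := by
    rintro x y z h rfl
    have h1 := hE _ h
    have h2 : ({x, x, z} : Finset V).card ≤ 2 := by
      rw [Finset.insert_eq_of_mem (by simp)]
      exact Finset.card_le_two
    omega
  have hs1 : ∀ x y z : V, ({x, y, z} : Finset V) ∈ E → ({y, x, z} : Finset V) ∈ E := by
    intro x y z h
    rwa [Finset.insert_comm]
  have hs2 : ∀ x y z : V, ({x, y, z} : Finset V) ∈ E → ({x, z, y} : Finset V) ∈ E := by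
    intro x y z h
    rwa [Finset.pair_comm]
  obtain ⟨G, hGdef⟩ : ∃ G : V → V → V → Prop, ∀ x y z, G x y z ↔ ({x, y, z} : Finset V) ∈ E :=
    ⟨_, fun _ _ _ => Iff.rfl⟩
  have hgood : GoodRel ε V G := by
    refine ⟨?_, ?_, ?_, ?_⟩
    · intro x y z; rw [hGdef, hGdef]; exact hs1 x y z
    · intro x y z; rw [hGdef, hGdef]; exact hs2 x y z
    · intro x y z; rw [hGdef]; exact hne x y z
    · intro u v huv
      refine (hcod u v huv).trans ?_
      norm_cast
      refine (Finset.card_le_card ?_).trans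
        (Finset.card_image_le (f := fun w => ({u, v, w} : Finset V)))
      intro s hs
      rw [Finset.mem_filter] at hs
      obtain ⟨hsE, hus, hvs⟩ := hs
      have hsub : ({u, v} : Finset V) ⊆ s := by
        intro x hx
        rw [Finset.mem_insert, Finset.mem_singleton] at hx
        rcases hx with rfl | rfl <;> assumption
      have hc1 : (s \ {u, v}).card = 1 := by
        rw [Finset.card_sdiff_of_subset hsub, hE s hsE, Finset.card_pair huv]
      obtain ⟨w, hw⟩ := Finset.card_eq_one.1 hc1
      have hsw : ({u, v, w} : Finset V) = s := by
        rw [← Finset.sdiff_union_of_subset hsub, hw]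
        ext x
        simp only [Finset.mem_insert, Finset.mem_singleton, Finset.mem_union]
        tauto
      rw [Finset.mem_image]
      refine ⟨w, ?_, hsw⟩
      rw [Finset.mem_filter, hGdef, hsw]
      exact ⟨Finset.mem_univ _, hsE⟩
  obtain ⟨a, e, B, C, D, hB, hC, hD, heB, hG⟩ := h V G hgood hn
  obtain ⟨b, hbB, hb⟩ := enum_of_card B ℓ (by omega) hB
  obtain ⟨c, hcC, hc⟩ := enum_of_card C ℓ (by omega) hC
  obtain ⟨d, hdD, hd⟩ := enum_of_card D ℓ (by omega) hD
  obtain ⟨g, hg1, hg2, hg3⟩ := seq_of_blowup G ℓ hℓ hgood.1 hgood.2.1 hgood.2.2.1 a e b c d hb hc hd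
    (fun i hi => heB (hi ▸ hbB i)) (fun i j k => hG _ (hbB i) _ (hcC j) _ (hdD k))
  obtain ⟨f, hf1, hf2⟩ := cycle_of_seq G ℓ hℓ g hg1 hg2 hg3
  exact ⟨f, hf1, fun i hi => (hGdef _ _ _).1 (hf2 i hi)⟩
end
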